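/- The signed dual Littlewood identity for self-conjugate partitions: ∑_λ (-1)^{(|λ|+d(λ))/2} s_λ(x_1,...,x_n) = ∏_{i=1}^n (1 - x_i) · ∏_{1≤i<j≤n} (1 - x_i x_j), where the sum is over all self-conjugate partitions λ (i.e., λ = λ') with at most n rows, and d(λ) is the size of the Durfee square of λ. -/

import Mathlib

open MvPolynomial

/-- The size of the Durfee square of a Young diagram: the number of diagonal cells. -/
def durfee (μ : YoungDiagram) : ℕ := (μ.cells.filter fun c => c.1 = c.2).card

/-- The Schur polynomial `s_μ(x_1, …, x_n)` with integer coefficients, defined via the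
Jacobi–Trudi formula `s_μ = det(h_{μ_i - i + j})_{1 ≤ i,j ≤ ℓ(μ)}` (zero-indexed), where
`h_m` is the complete homogeneous symmetric polynomial and `h_m = 0` for `m < 0`. -/
noncomputable def schurPoly (n : ℕ) (μ : YoungDiagram) : MvPolynomial (Fin n) ℤ :=
  Matrix.det (Matrix.of fun i j : Fin (μ.colLen 0) =>
    if (i : ℕ) ≤ μ.rowLen i + (j : ℕ) then
      MvPolynomial.hsymm (Fin n) ℤ (μ.rowLen i + (j : ℕ) - (i : ℕ))
    else 0)


theorem hsymm_eq_coeff (n m : ℕ) : hsymm (Fin n) ℤ m =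
    PowerSeries.coeff m (∏ k : Fin n, PowerSeries.mk fun d => (X k : MvPolynomial (Fin n) ℤ) ^ d) := by
  rw [PowerSeries.coeff_prod, hsymm]
  refine Finset.sum_bij' (fun s _ => ((Sym.equivNatSum (Fin n) m s : {P : Fin n →₀ ℕ // _}) : Fin n →₀ ℕ))
    (fun l hl => (Sym.equivNatSum (Fin n) m).symm ⟨l, by
      have := Finset.mem_finsuppAntidiag.1 hl
      rw [Finsupp.sum_fintype _ _ (by simp)]; simpa using this.1⟩) ?_ ?_ ?_ ?_ ?_
  · intro s _
    rw [Finset.mem_finsuppAntidiag]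
    obtain ⟨P, hP⟩ := Sym.equivNatSum (Fin n) m s
    rw [Finsupp.sum_fintype _ _ (by simp)] at hP
    exact ⟨by simpa using hP, Finset.subset_univ _⟩
  · simp
  · simp
  · simp
  · intro s _
    rw [Finset.prod_multiset_map_count]
    simp only [PowerSeries.coeff_mk, Sym.coe_equivNatSum_apply_apply]
    refine Finset.prod_subset (Finset.subset_univ _) ?_
    intro x _ hx
    have : Multiset.count x (s : Multiset (Fin n)) = 0 := Multiset.count_eq_zero.2 (by simpa using hx)
    erw [this]; simp

/-- The generating series. -/
noncomputable def HS (n : ℕ) : PowerSeries (MvPolynomial (Fin n) ℤ) :=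
  PowerSeries.mk fun m => hsymm (Fin n) ℤ m

theorem HS_eq (n : ℕ) : HS n =
    ∏ k : Fin n, PowerSeries.mk fun d => (X k : MvPolynomial (Fin n) ℤ) ^ d := by
  ext1 m
  rw [← hsymm_eq_coeff, HS, PowerSeries.coeff_mk]

theorem geo {R : Type*} [CommRing R] (x : R) :
    (PowerSeries.mk fun d => x ^ d) *
      ((1 - Polynomial.C x * Polynomial.X : Polynomial R) : PowerSeries R) = 1 := by
  ext m
  have : ((1 - Polynomial.C x * Polynomial.X : Polynomial R) : PowerSeries R)
    = 1 - PowerSeries.C x * PowerSeries.X := by simp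
  rw [this, mul_sub, ← mul_assoc, mul_one, map_sub]
  cases m with
  | zero => simp
  | succ m => simp [PowerSeries.coeff_succ_mul_X, PowerSeries.coeff_one, pow_succ]

/-- Product over a subset. -/
noncomputable def PE (n : ℕ) (s : Finset (Fin n)) : Polynomial (MvPolynomial (Fin n) ℤ) :=
  ∏ k ∈ s, (1 - Polynomial.C (X k) * Polynomial.X)

theorem PE_natDegree (n : ℕ) (s : Finset (Fin n)) : (PE n s).natDegree ≤ s.card := by
  refine (Polynomial.natDegree_prod_le _ _).trans ?_
  refine (Finset.sum_le_card_nsmul _ _ 1 ?_).trans (by simp)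
  intro k _
  compute_degree

theorem PE_coeff_zero (n : ℕ) (s : Finset (Fin n)) : (PE n s).coeff 0 = 1 := by
  rw [Polynomial.coeff_zero_eq_eval_zero, PE, Polynomial.eval_prod]
  simp

theorem HS_mul_PE_univ (n : ℕ) : HS n * (PE n Finset.univ : PowerSeries _) = 1 := by
  rw [HS_eq, PE, ← Polynomial.coeToPowerSeries.ringHom_apply, map_prod, ← Finset.prod_mul_distrib]
  simp only [Polynomial.coeToPowerSeries.ringHom_apply, geo, Finset.prod_const_one]

theorem HS_mul_PE_erase (n : ℕ) (k : Fin n) :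
    HS n * (PE n (Finset.univ.erase k) : PowerSeries _) = PowerSeries.mk fun d => X k ^ d := by
  have h1 := HS_mul_PE_univ n
  have h2 : PE n Finset.univ = (1 - Polynomial.C (X k) * Polynomial.X) * PE n (Finset.univ.erase k) := by
    rw [PE, PE, Finset.mul_prod_erase _ (fun k : Fin n => (1 - Polynomial.C (X k : MvPolynomial (Fin n) ℤ) * Polynomial.X)) (Finset.mem_univ k)]
  have h3 := geo (X k : MvPolynomial (Fin n) ℤ)
  rw [h2, Polynomial.coe_mul] at h1
  calc _ = HS n * (PE n (Finset.univ.erase k) : PowerSeries _) * ((PowerSeries.mk fun d => (X k : MvPolynomial (Fin n) ℤ) ^ d) * _) := by rw [h3, mul_one]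
    _ = (PowerSeries.mk fun d => X k ^ d) * (HS n * ((↑(1 - Polynomial.C (X k) * Polynomial.X : Polynomial (MvPolynomial (Fin n) ℤ))) * (PE n (Finset.univ.erase k) : PowerSeries _))) := by ring
    _ = _ := by rw [h1, mul_one]

/-- Complete symmetric polynomial with integer index. -/
noncomputable def hz (n : ℕ) (m : ℤ) : MvPolynomial (Fin n) ℤ :=
  if 0 ≤ m then hsymm (Fin n) ℤ m.toNat else 0

theorem conv (n N m : ℕ) (P : Polynomial (MvPolynomial (Fin n) ℤ)) (hP : P.natDegree < N) :
    ∑ b : Fin N, hz n ((m : ℤ) - (b : ℕ)) * P.coeff b = PowerSeries.coeff m (HS n * (P : PowerSeries _)) := by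
  rw [mul_comm, PowerSeries.coeff_mul, Finset.Nat.sum_antidiagonal_eq_sum_range_succ_mk,
    Fin.sum_univ_eq_sum_range (fun b => hz n ((m : ℤ) - (b : ℕ)) * P.coeff b)]
  have e1 : ∀ b ∈ Finset.range (m+1), PowerSeries.coeff b (P : PowerSeries _) * PowerSeries.coeff (m - b) (HS n)
      = hz n ((m : ℤ) - (b : ℕ)) * P.coeff b := by
    intro b hb
    have hb : b ≤ m := by simpa [Nat.lt_succ_iff] using hb
    rw [hz, if_pos (by omega), HS, PowerSeries.coeff_mk, Polynomial.coeff_coe, mul_comm]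
    congr 2
    omega
  rw [Finset.sum_congr rfl e1]
  rcases le_total N (m+1) with h | h
  · refine Finset.sum_subset (by simpa using h) ?_
    intro b _ hb
    rw [Polynomial.coeff_eq_zero_of_natDegree_lt (by simp at hb; omega), mul_zero]
  · refine (Finset.sum_subset (by simpa using h) ?_).symm
    intro b _ hb
    rw [hz, if_neg (by simp at hb; omega), zero_mul]


/-- Auxiliary polynomials. -/
noncomputable def pp (K : Type*) [Field K] : ℕ → Polynomial K
  | 0 => 1
  | 1 => Polynomial.X + 1
  | (m+2) => Polynomial.X * pp K (m+1) - pp K m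

theorem pp_deg (K : Type*) [Field K] (m : ℕ) : (pp K m).Monic ∧ (pp K m).natDegree = m := by
  induction m using Nat.twoStepInduction with
  | zero => simp [pp]
  | one =>
    constructor
    · simpa [pp] using Polynomial.monic_X_add_C (1 : K)
    · simpa [pp] using Polynomial.natDegree_X_add_C (1 : K)
  | more m h0 h1 =>
    have hm : (Polynomial.X * pp K (m+1)).Monic := Polynomial.monic_X.mul h1.1
    have hd : (Polynomial.X * pp K (m+1)).natDegree = m + 2 := by
      rw [Polynomial.natDegree_X_mul h1.1.ne_zero, h1.2]
    have hlt : (pp K m).degree < (Polynomial.X * pp K (m+1)).degree := by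
      rw [Polynomial.degree_eq_natDegree hm.ne_zero, hd, Polynomial.degree_eq_natDegree h0.1.ne_zero, h0.2]
      exact_mod_cast (by omega)
    rw [pp]
    refine ⟨hm.sub_of_left hlt, ?_⟩
    rw [Polynomial.natDegree_eq_of_degree_eq (Polynomial.degree_sub_eq_left_of_degree_lt hlt), hd]

theorem pp_eval {K : Type*} [Field K] (x : K) (hx : x ≠ 0) (m : ℕ) :
    x ^ m * (pp K m).eval (x + x⁻¹) * (1 - x) = 1 - x ^ (2 * m + 1) := by
  induction m using Nat.twoStepInduction with
  | zero => simp [pp]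
  | one => simp [pp]; field_simp; ring
  | more m h0 h1 =>
    rw [pp, Polynomial.eval_sub, Polynomial.eval_mul, Polynomial.eval_X]
    have : x * (x + x⁻¹) = x ^ 2 + 1 := by field_simp
    calc _ = (x * (x + x⁻¹)) * (x ^ (m+1) * (pp K (m+1)).eval (x + x⁻¹) * (1 - x))
          - x ^ 2 * (x ^ m * (pp K m).eval (x + x⁻¹) * (1 - x)) := by ring
      _ = _ := by rw [h0, h1, this]; ring

theorem prod_lt {R : Type*} [CommRing R] (n : ℕ) (f : Fin n → Fin n → R) :
    ∏ p ∈ Finset.univ.filter (fun p : Fin n × Fin n => p.1 < p.2), f p.1 p.2 =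
      ∏ i, ∏ j ∈ Finset.Ioi i, f i j := by
  rw [Finset.prod_filter, Fintype.prod_prod_type]
  refine Finset.prod_congr rfl fun i _ => ?_
  rw [← Finset.prod_filter]
  refine Finset.prod_congr ?_ fun _ _ => rfl
  ext j; simp

theorem weylB_rev {K : Type*} [Field K] (n : ℕ) (x : Fin n → K) (hx : ∀ i, x i ≠ 0) :
    Matrix.det (Matrix.of fun i k : Fin n => x k ^ (i.rev : ℕ) - x k ^ (n + (i : ℕ))) =
      Matrix.det (Matrix.of fun i k : Fin n => x k ^ (i.rev : ℕ)) *
      ((∏ i : Fin n, (1 - x i)) * ∏ p ∈ Finset.univ.filter (fun p : Fin n × Fin n => p.1 < p.2),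
            (1 - x p.1 * x p.2)) := by
  rw [← Matrix.det_transpose, ← Matrix.det_transpose (Matrix.of fun i k : Fin n => x k ^ (i.rev : ℕ))]
  have e1 : (Matrix.of fun i k : Fin n => x k ^ (i.rev : ℕ)).transpose = Matrix.projVandermonde 1 x := by
    ext i j; simp [Matrix.projVandermonde_apply]
  have e2 : (Matrix.of fun i k : Fin n => x k ^ (i.rev : ℕ) - x k ^ (n + (i : ℕ))).transpose =
      Matrix.of fun k m : Fin n => ((1 - x k) * x k ^ (n-1)) *
        (Matrix.of fun k m : Fin n => (pp K m).eval (x k + (x k)⁻¹)) k m := by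
    ext k m
    have h := pp_eval (x k) (hx k) m
    have h1 : n - 1 = (m.rev : ℕ) + m := by rw [Fin.val_rev]; omega
    have h2 : n + (m : ℕ) = (m.rev : ℕ) + (2 * m + 1) := by rw [Fin.val_rev]; omega
    simp only [Matrix.transpose_apply, Matrix.of_apply]
    rw [h1, h2, pow_add, pow_add _ _ (m : ℕ)]
    linear_combination (-(x k ^ (m.rev : ℕ))) * h
  have e3 : Matrix.projVandermonde (fun k => 1 + x k ^ 2) x = Matrix.of fun k m : Fin n => (x k ^ (n-1)) *
        Matrix.vandermonde (fun k => x k + (x k)⁻¹) k m := by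
    ext k m
    have h1 : n - 1 = (m.rev : ℕ) + m := by rw [Fin.val_rev]; omega
    have : 1 + x k ^ 2 = x k * (x k + (x k)⁻¹) := by have := hx k; field_simp; ring
    simp only [Matrix.projVandermonde_apply, Matrix.of_apply, Matrix.vandermonde_apply]
    rw [this, h1, mul_pow, pow_add]; ring
  have e4 := congrArg Matrix.det e3
  rw [Matrix.det_mul_column, Matrix.det_projVandermonde] at e4
  have e5 : Matrix.det (Matrix.vandermonde (fun k => x k + (x k)⁻¹)) =
      Matrix.det (Matrix.of fun k m : Fin n => (pp K m).eval (x k + (x k)⁻¹)) :=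
    Matrix.det_eval_matrixOfPolynomials_eq_det_vandermonde _ (fun m : Fin n => pp K m)
      (fun m => (pp_deg K m).2) (fun m => (pp_deg K m).1)
  rw [e1, e2, Matrix.det_mul_column, ← e5, Finset.prod_mul_distrib, mul_assoc, ← e4,
    Matrix.det_projVandermonde, prod_lt n (fun i j => 1 - x i * x j), mul_left_comm]
  congr 1
  simp_rw [← Finset.prod_mul_distrib]
  refine Finset.prod_congr rfl fun i _ => Finset.prod_congr rfl fun j _ => ?_
  simp only [Pi.one_apply]
  ring

theorem weylB {K : Type*} [Field K] (n : ℕ) (x : Fin n → K) (hx : ∀ i, x i ≠ 0) :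
    Matrix.det (Matrix.of fun i k : Fin n => x k ^ (i : ℕ) - x k ^ (2 * n - 1 - (i : ℕ))) =
      Matrix.det (Matrix.of fun i k : Fin n => x k ^ (i : ℕ)) *
      ((∏ i : Fin n, (1 - x i)) * ∏ p ∈ Finset.univ.filter (fun p : Fin n × Fin n => p.1 < p.2),
            (1 - x p.1 * x p.2)) := by
  have h := weylB_rev n x hx
  have f1 : (Matrix.of fun i k : Fin n => x k ^ (i.rev : ℕ) - x k ^ (n + (i : ℕ))) =
    (Matrix.of fun i k : Fin n => x k ^ (i : ℕ) - x k ^ (2 * n - 1 - (i : ℕ))).submatrix Fin.revPerm id := by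
    ext i k
    simp only [Matrix.submatrix_apply, Matrix.of_apply, Fin.revPerm_apply, id]
    congr 2
    rw [Fin.val_rev]; omega
  have f2 : (Matrix.of fun i k : Fin n => x k ^ (i.rev : ℕ)) =
    (Matrix.of fun i k : Fin n => x k ^ (i : ℕ)).submatrix Fin.revPerm id := by
    ext i k
    simp
  rw [f1, f2, Matrix.det_permute, Matrix.det_permute, mul_assoc] at h
  refine mul_left_cancel₀ ?_ h
  rcases Int.units_eq_one_or (Equiv.Perm.sign (Fin.revPerm : Equiv.Perm (Fin n))) with h | h <;> simp [h]

/-- Add a hook of arm `n` and leg `n`. -/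
def addHook (n : ℕ) (μ : YoungDiagram) : YoungDiagram where
  cells := (Finset.range (n+1) ×ˢ Finset.range (n+1)).filter
    (fun c => c.1 = 0 ∨ c.2 = 0 ∨ (c.1 - 1, c.2 - 1) ∈ μ.cells)
  isLowerSet := by
    rintro ⟨a, b⟩ ⟨c, d⟩ ⟨h1, h2⟩ h
    simp only [Finset.coe_filter, Finset.mem_product, Finset.mem_range, Set.mem_ofPred_eq,
      YoungDiagram.mem_cells] at *
    refine ⟨⟨by omega, by omega⟩, ?_⟩
    rcases h.2 with h | h | h
    · left; omega
    · right; left; omega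
    · right; right; exact μ.up_left_mem (by omega) (by omega) h

theorem mem_addHook (n : ℕ) (μ : YoungDiagram) (i j : ℕ) :
    (i, j) ∈ addHook n μ ↔ (i ≤ n ∧ j ≤ n) ∧ (i = 0 ∨ j = 0 ∨ (i - 1, j - 1) ∈ μ) := by
  rw [← YoungDiagram.mem_cells]
  simp [addHook]

/-- Remove the first row and column. -/
def remHook (μ : YoungDiagram) : YoungDiagram where
  cells := μ.cells.filter (fun c => (c.1 + 1, c.2 + 1) ∈ μ.cells)
  isLowerSet := by
    rintro ⟨a, b⟩ ⟨c, d⟩ ⟨h1, h2⟩ h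
    simp only [Finset.coe_filter, Set.mem_ofPred_eq, YoungDiagram.mem_cells] at *
    exact ⟨μ.up_left_mem h1 h2 h.1, μ.up_left_mem (by omega) (by omega) h.2⟩

theorem mem_remHook (μ : YoungDiagram) (i j : ℕ) :
    (i, j) ∈ remHook μ ↔ (i + 1, j + 1) ∈ μ := by
  rw [← YoungDiagram.mem_cells]
  simp only [remHook, Finset.mem_filter, YoungDiagram.mem_cells]
  exact ⟨fun h => h.2, fun h => ⟨μ.up_left_mem (by omega) (by omega) h, h⟩⟩

theorem yd_ext {μ ν : YoungDiagram} (h : ∀ i j, (i, j) ∈ μ ↔ (i, j) ∈ ν) : μ = ν := by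
  apply YoungDiagram.ext
  ext ⟨i, j⟩
  exact h i j

theorem sc_iff (μ : YoungDiagram) : μ.transpose = μ ↔ ∀ i j, (i, j) ∈ μ ↔ (j, i) ∈ μ := by
  constructor
  · intro h i j
    conv_lhs => rw [← h]
    simp [YoungDiagram.mem_transpose]
  · intro h
    exact yd_ext fun i j => by rw [YoungDiagram.mem_transpose]; exact (h i j).symm

theorem colLen_le_iff (μ : YoungDiagram) (n : ℕ) : μ.colLen 0 ≤ n ↔ (n, 0) ∉ μ := by
  rw [YoungDiagram.mem_iff_lt_colLen]; omega

open Classical in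
/-- Self-conjugate diagrams with at most `n` rows. -/
noncomputable def SC : ℕ → Finset YoungDiagram
  | 0 => {⊥}
  | (n+1) => SC n ∪ (SC n).image (addHook n)

theorem mem_SC (n : ℕ) : ∀ μ, μ ∈ SC n ↔ μ.transpose = μ ∧ μ.colLen 0 ≤ n := by
  induction n with
  | zero =>
    intro μ
    simp only [SC, Finset.mem_singleton, sc_iff, colLen_le_iff]
    constructor
    · rintro rfl; simp
    · rintro ⟨_, h⟩
      refine yd_ext fun i j => ?_
      simp only [YoungDiagram.notMem_bot, iff_false]
      exact fun h' => h (μ.up_left_mem (by omega) (by omega) h')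
  | succ n ih =>
    intro μ
    simp only [SC, Finset.mem_union, Finset.mem_image, ih, sc_iff, colLen_le_iff]
    constructor
    · rintro (⟨h1, h2⟩ | ⟨ν, ⟨h1, h2⟩, rfl⟩)
      · exact ⟨h1, fun h => h2 (μ.up_left_mem (by omega) (by omega) h)⟩
      · refine ⟨fun i j => ?_, ?_⟩
        · rw [mem_addHook, mem_addHook, h1]; tauto
        · rw [mem_addHook]; omega
    · rintro ⟨h1, h2⟩
      by_cases h3 : (n, 0) ∈ μ
      · right
        refine ⟨remHook μ, ⟨fun i j => ?_, ?_⟩, ?_⟩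
        · rw [mem_remHook, mem_remHook, h1]
        · rw [mem_remHook]
          exact fun h => h2 (μ.up_left_mem (by omega) (by omega) h)
        · refine yd_ext fun i j => ?_
          rw [mem_addHook, mem_remHook]
          have h3' := (h1 _ _).1 h3
          have h2' : (0, n+1) ∉ μ := fun h => h2 ((h1 _ _).1 h)
          constructor
          · rintro ⟨⟨ha, hb⟩, h⟩
            rcases Nat.eq_zero_or_pos i with rfl | hi
            · exact μ.up_left_mem le_rfl hb h3'
            rcases Nat.eq_zero_or_pos j with rfl | hj
            · exact μ.up_left_mem ha le_rfl h3
            rw [Nat.sub_add_cancel hi, Nat.sub_add_cancel hj] at h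
            rcases h with h | h | h
            · omega
            · omega
            · exact h
          · intro h
            have ha : i ≤ n := by
              by_contra hc
              exact h2 (μ.up_left_mem (by omega) (by omega) h)
            have hb : j ≤ n := by
              by_contra hc
              exact h2' (μ.up_left_mem (by omega) (by omega) h)
            refine ⟨⟨ha, hb⟩, ?_⟩
            rcases Nat.eq_zero_or_pos i with rfl | hi
            · simp
            rcases Nat.eq_zero_or_pos j with rfl | hj
            · simp
            rw [Nat.sub_add_cancel hi, Nat.sub_add_cancel hj]
            tauto
      · left; exact ⟨h1, h3⟩

theorem SC_bound {n : ℕ} {μ : YoungDiagram} (h : μ ∈ SC n) {i j : ℕ} (hij : (i, j) ∈ μ) :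
    i < n ∧ j < n := by
  rw [mem_SC, sc_iff, colLen_le_iff] at h
  constructor
  · by_contra hc
    exact h.2 (μ.up_left_mem (by omega) (by omega) hij)
  · by_contra hc
    exact h.2 ((h.1 _ _).1 (μ.up_left_mem (by omega) (by omega) hij))

theorem addHook_inj {n : ℕ} {μ ν : YoungDiagram} (hμ : μ ∈ SC n) (hν : ν ∈ SC n)
    (h : addHook n μ = addHook n ν) : μ = ν := by
  have key : ∀ i j, i < n → j < n → ((i, j) ∈ μ ↔ (i, j) ∈ ν) := by
    intro i j hi hj
    have : (i+1, j+1) ∈ addHook n μ ↔ (i+1, j+1) ∈ addHook n ν := by rw [h]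
    simpa [mem_addHook, Nat.succ_le_iff, hi, hj] using this
  refine yd_ext fun i j => ⟨fun h => ?_, fun h => ?_⟩
  · exact (key i j (SC_bound hμ h).1 (SC_bound hμ h).2).1 h
  · exact (key i j (SC_bound hν h).1 (SC_bound hν h).2).2 h

theorem rowLen_eq_of {μ : YoungDiagram} {i r : ℕ} (h : ∀ j, (i, j) ∈ μ ↔ j < r) : μ.rowLen i = r := by
  have h' : ∀ j, j < μ.rowLen i ↔ j < r := fun j => by rw [← h, YoungDiagram.mem_iff_lt_rowLen]
  have := h' r; have := h' (μ.rowLen i); omega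

theorem addHook_rowLen_zero (n : ℕ) (μ : YoungDiagram) : (addHook n μ).rowLen 0 = n + 1 :=
  rowLen_eq_of fun j => by rw [mem_addHook]; omega

theorem addHook_rowLen_succ {n : ℕ} {μ : YoungDiagram} (hμ : μ ∈ SC n) (i : ℕ) (hi : i < n) :
    (addHook n μ).rowLen (i + 1) = μ.rowLen i + 1 :=
  rowLen_eq_of fun j => by
    rw [mem_addHook]
    rcases j with _ | j
    · simp; omega
    · simp only [Nat.add_sub_cancel, YoungDiagram.mem_iff_lt_rowLen]
      have : j < μ.rowLen i → j < n := fun h =>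
        (SC_bound hμ (YoungDiagram.mem_iff_lt_rowLen.2 h)).2
      omega

/-- Shift embedding. -/
def shiftEmb : ℕ × ℕ ↪ ℕ × ℕ := ⟨fun c => (c.1 + 1, c.2 + 1), fun a b h => by
  simp at h; exact Prod.ext h.1 h.2⟩

theorem shiftEmb_apply (a b : ℕ) : shiftEmb (a, b) = (a + 1, b + 1) := rfl

theorem addHook_cells {n : ℕ} {μ : YoungDiagram} (hμ : μ ∈ SC n) :
    (addHook n μ).cells = (({0} ×ˢ Finset.range (n+1)) ∪ ((Finset.range (n+1)).erase 0 ×ˢ {0})) ∪ μ.cells.map shiftEmb := by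
  ext ⟨i, j⟩
  rw [YoungDiagram.mem_cells, mem_addHook]
  simp only [Finset.mem_union, Finset.mem_product, Finset.mem_singleton, Finset.mem_range,
    Finset.mem_erase, Finset.mem_map, shiftEmb_apply, Prod.mk.injEq, YoungDiagram.mem_cells,
    Prod.exists]
  constructor
  · rintro ⟨⟨h1, h2⟩, h⟩
    by_cases hi : i = 0
    · left; left; omega
    by_cases hj : j = 0
    · left; right; omega
    · right
      exact ⟨i-1, j-1, by tauto, by omega, by omega⟩
  · rintro ((h | h) | ⟨a, b, h, rfl, rfl⟩)
    · omega
    · omega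
    · have := SC_bound hμ h
      exact ⟨by omega, by simp [h]⟩

theorem addHook_card {n : ℕ} {μ : YoungDiagram} (hμ : μ ∈ SC n) :
    (addHook n μ).card = μ.card + (2 * n + 1) := by
  rw [YoungDiagram.card, addHook_cells hμ, Finset.card_union_of_disjoint, Finset.card_union_of_disjoint]
  · simp [YoungDiagram.card]; omega
  · rw [Finset.disjoint_left]; rintro ⟨i, j⟩; simp; omega
  · rw [Finset.disjoint_left]; rintro ⟨i, j⟩; simp only [Finset.mem_union, Finset.mem_product, Finset.mem_singleton, Finset.mem_range,
      Finset.mem_erase, Finset.mem_map, shiftEmb_apply, Prod.exists, Prod.mk.injEq]; rintro h ⟨a, b, _, h1, h2⟩; omega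

theorem addHook_durfee {n : ℕ} {μ : YoungDiagram} (hμ : μ ∈ SC n) :
    durfee (addHook n μ) = durfee μ + 1 := by
  rw [durfee, addHook_cells hμ]
  have : ((({0} ×ˢ Finset.range (n+1)) ∪ ((Finset.range (n+1)).erase 0 ×ˢ {0})) ∪ μ.cells.map shiftEmb).filter (fun c => c.1 = c.2)
      = insert (0, 0) ((μ.cells.filter fun c => c.1 = c.2).map shiftEmb) := by
    ext ⟨i, j⟩
    simp only [Finset.mem_filter, Finset.mem_insert, Finset.mem_union, Finset.mem_product, Finset.mem_singleton, Finset.mem_range,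
      Finset.mem_erase, Finset.mem_map, shiftEmb_apply, Prod.mk.injEq, YoungDiagram.mem_cells,
      Prod.exists]
    constructor
    · rintro ⟨(h | h) | ⟨a, b, h, rfl, rfl⟩, h'⟩
      · left; omega
      · left; omega
      · right; exact ⟨a, b, ⟨h, by omega⟩, rfl, rfl⟩
    · rintro (h | ⟨a, b, ⟨h, h'⟩, rfl, rfl⟩)
      · refine ⟨Or.inl (Or.inl (by omega)), by omega⟩
      · exact ⟨Or.inr ⟨a, b, h, rfl, rfl⟩, by omega⟩
  rw [this, Finset.card_insert_of_notMem (by simp [shiftEmb_apply]), Finset.card_map, durfee]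

open Classical in
theorem SC_disj (n : ℕ) : Disjoint (SC n) ((SC n).image (addHook n)) := by
  rw [Finset.disjoint_left]
  intro μ h h'
  obtain ⟨ν, _, rfl⟩ := Finset.mem_image.1 h'
  have : (n, 0) ∈ addHook n ν := by rw [mem_addHook]; simp
  exact absurd (SC_bound h this).1 (lt_irrefl _)

open Classical in
theorem altsum {R M N : Type*} [CommRing R] [AddCommGroup M] [Module R M] [AddCommGroup N] [Module R N]
    (w : ℤ → M) (n : ℕ) : ∀ f : M [⋀^Fin n]→ₗ[R] N,
    ∑ μ ∈ SC n, (-1 : R) ^ ((μ.card + durfee μ) / 2) •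
      f (fun i => w ((μ.rowLen i.rev : ℤ) - ((i.rev : ℕ) : ℤ))) =
    f (fun i => w (-((i.rev : ℕ) : ℤ)) - w (((i.rev : ℕ) : ℤ) + 1)) := by
  induction n with
  | zero =>
    intro f
    simp only [SC, Finset.sum_singleton]
    have : durfee ⊥ = 0 := by simp [durfee]
    rw [this]
    simp [YoungDiagram.card]
    congr 1
    exact Subsingleton.elim _ _
  | succ n ih =>
    intro f
    rw [SC, Finset.sum_union (SC_disj n), Finset.sum_image (s := SC n) (g := addHook n) (fun a ha b hb h => addHook_inj ha hb h),
      ← Finset.sum_add_distrib]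
    have key := ih (f.curryLeft (w (-(n : ℤ)) - w ((n : ℤ) + 1)))
    have rhs : (fun i : Fin (n+1) => w (-((i.rev : ℕ) : ℤ)) - w (((i.rev : ℕ) : ℤ) + 1)) =
        Matrix.vecCons (w (-(n : ℤ)) - w ((n : ℤ) + 1))
          (fun i : Fin n => w (-((i.rev : ℕ) : ℤ)) - w (((i.rev : ℕ) : ℤ) + 1)) := by
      ext i
      refine Fin.cases ?_ (fun j => ?_) i
      · simp
      · simp [Fin.rev_succ]
    rw [rhs, ← AlternatingMap.curryLeft_apply_apply, ← key]
    refine Finset.sum_congr rfl fun μ hμ => ?_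
    have hrow : μ.rowLen n = 0 := by
      by_contra hc
      exact absurd (SC_bound hμ (YoungDiagram.mem_iff_lt_rowLen.2 (Nat.pos_of_ne_zero hc))).1 (lt_irrefl _)
    have v1 : (fun i : Fin (n+1) => w ((μ.rowLen i.rev : ℤ) - ((i.rev : ℕ) : ℤ))) =
        Matrix.vecCons (w (-(n : ℤ))) (fun i : Fin n => w ((μ.rowLen i.rev : ℤ) - ((i.rev : ℕ) : ℤ))) := by
      ext i
      refine Fin.cases ?_ (fun j => ?_) i
      · simp [hrow]
      · simp [Fin.rev_succ]
    have v2 : (fun i : Fin (n+1) => w (((addHook n μ).rowLen i.rev : ℤ) - ((i.rev : ℕ) : ℤ))) =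
        (Matrix.vecCons (w ((n : ℤ) + 1)) (fun i : Fin n => w ((μ.rowLen i.rev : ℤ) - ((i.rev : ℕ) : ℤ)))) ∘ finRotate (n+1) := by
      have hs := Fin.snoc_eq_cons_rotate (fun i : Fin n => w ((μ.rowLen i.rev : ℤ) - ((i.rev : ℕ) : ℤ))) (w ((n : ℤ) + 1))
      refine Eq.trans ?_ hs
      ext i
      refine Fin.lastCases ?_ (fun j => ?_) i
      · simp [addHook_rowLen_zero]
      · rw [Fin.snoc_castSucc, Fin.rev_castSucc, Fin.val_succ, addHook_rowLen_succ hμ _ j.rev.isLt]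
        congr 1
        push_cast
        ring
    rw [v1, v2, AlternatingMap.map_perm, sign_finRotate, ← AlternatingMap.curryLeft_apply_apply,
      ← AlternatingMap.curryLeft_apply_apply, addHook_card hμ, addHook_durfee hμ, map_sub,
      show (μ.card + (2 * n + 1) + (durfee μ + 1)) / 2 = (μ.card + durfee μ) / 2 + n + 1 by omega,
      AlternatingMap.sub_apply, smul_sub, sub_eq_add_neg]
    congr 1
    rw [pow_succ, pow_add, Nat.add_sub_cancel]
    rcases Nat.even_or_odd n with h | h <;> simp [h.neg_one_pow]

theorem schur_pad (n : ℕ) (μ : YoungDiagram) (N : ℕ) (hN : μ.colLen 0 ≤ N) :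
    schurPoly n μ = Matrix.det (Matrix.of fun i j : Fin N =>
      hz n ((μ.rowLen i : ℤ) - ((i : ℕ) : ℤ) + ((j : ℕ) : ℤ))) := by
  induction N, hN using Nat.le_induction with
  | base =>
    rw [schurPoly]
    congr 1
    ext1 i j
    simp only [Matrix.of_apply, hz]
    by_cases h : (i : ℕ) ≤ μ.rowLen i + (j : ℕ)
    · rw [if_pos h, if_pos (by omega)]
      congr 1
      omega
    · rw [if_neg h, if_neg (by omega)]
  | succ N hN ih =>
    have hrow : μ.rowLen N = 0 := by
      by_contra hc
      have h1 : (N, 0) ∈ μ := YoungDiagram.mem_iff_lt_rowLen.2 (Nat.pos_of_ne_zero hc)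
      rw [YoungDiagram.mem_iff_lt_colLen] at h1
      omega
    rw [ih, Matrix.det_succ_row _ (Fin.last N), Finset.sum_eq_single (Fin.last N)]
    · have : hz n 0 = 1 := by simp [hz]
      simp only [Matrix.of_apply, Fin.val_last, hrow]
      rw [show ((0 : ℕ) : ℤ) - (N : ℤ) + (N : ℤ) = 0 by omega, this, ← two_mul, pow_mul]
      simp only [even_two, Even.neg_pow, one_pow, mul_one, one_mul]
      congr 1
      ext1 i j
      simp
    · intro j _ hj
      have : (j : ℕ) < N := by
        have := Fin.val_lt_last hj; exact this
      simp only [Matrix.of_apply, Fin.val_last, hrow]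
      rw [hz, if_neg (by omega)]
      simp
    · simp

theorem schur_vanish (n : ℕ) (μ : YoungDiagram) (hn : n < μ.colLen 0) : schurPoly n μ = 0 := by
  rw [schur_pad n μ _ le_rfl]
  apply Matrix.exists_mulVec_eq_zero_iff.1
  have hl : 0 < μ.colLen 0 := by omega
  refine ⟨fun j => (PE n Finset.univ).coeff (j.rev : ℕ), ?_, ?_⟩
  · intro h
    have := congrFun h (Fin.rev ⟨0, hl⟩)
    rw [Fin.rev_rev] at this
    simp [PE_coeff_zero] at this
  · ext1 i
    have hi : 0 < μ.rowLen i := by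
      rw [← YoungDiagram.mem_iff_lt_rowLen, YoungDiagram.mem_iff_lt_colLen]
      exact i.isLt
    have hc := conv n (μ.colLen 0) (μ.rowLen i + (i.rev : ℕ)) (PE n Finset.univ)
      (lt_of_le_of_lt (PE_natDegree _ _) (by simpa using hn))
    rw [HS_mul_PE_univ, PowerSeries.coeff_one, if_neg (by omega)] at hc
    rw [Pi.zero_apply, ← hc, Matrix.mulVec, dotProduct, ← Equiv.sum_comp Fin.revPerm]
    refine Finset.sum_congr rfl fun b _ => ?_
    simp only [Matrix.of_apply, Fin.revPerm_apply, Fin.rev_rev]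
    congr 2
    rw [Fin.val_rev, Fin.val_rev]
    omega

theorem final_det (n : ℕ) :
    Matrix.det (Matrix.of fun i b : Fin n => hz n (-((i.rev : ℕ) : ℤ) + ((b.rev : ℕ) : ℤ))
      - hz n (((i.rev : ℕ) : ℤ) + 1 + ((b.rev : ℕ) : ℤ))) =
      (∏ i : Fin n, (1 - X i : MvPolynomial (Fin n) ℤ)) *
          ∏ p ∈ Finset.univ.filter (fun p : Fin n × Fin n => p.1 < p.2),
            (1 - X p.1 * X p.2 : MvPolynomial (Fin n) ℤ) := by
  let C : Matrix (Fin n) (Fin n) (MvPolynomial (Fin n) ℤ) :=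
    Matrix.of fun b k => (PE n (Finset.univ.erase k)).coeff (b : ℕ)
  have key : ∀ (m : ℕ) (k : Fin n), ∑ b : Fin n, hz n ((m : ℤ) - (b : ℕ)) * C b k = X k ^ m := by
    intro m k
    have hn : 0 < n := k.pos
    simp only [C, Matrix.of_apply]
    rw [conv n n m _ (lt_of_le_of_lt (PE_natDegree _ _) (by
      rw [Finset.card_erase_of_mem (Finset.mem_univ k)]; simp; omega)), HS_mul_PE_erase,
      PowerSeries.coeff_mk]
  have hC : C.det = Matrix.det (Matrix.of fun i k : Fin n => (X k : MvPolynomial (Fin n) ℤ) ^ (i : ℕ)) := by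
    have h1 : (Matrix.of fun i b : Fin n => hz n (((i : ℕ) : ℤ) - (b : ℕ))) * C =
        Matrix.of fun i k : Fin n => (X k : MvPolynomial (Fin n) ℤ) ^ (i : ℕ) := by
      ext1 i k
      rw [Matrix.mul_apply]
      exact key i k
    have h3 : Matrix.det (Matrix.of fun i b : Fin n => hz n (((i : ℕ) : ℤ) - (b : ℕ))) = 1 := by
      rw [Matrix.det_of_isLowerTriangular]
      · simp [hz]
      · intro i j hij
        have : i < j := hij
        simp only [Matrix.of_apply]
        rw [hz, if_neg (by omega)]
    rw [← h1, Matrix.det_mul, h3, one_mul]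
  have hC0 : C.det ≠ 0 := by
    rw [hC, ← Matrix.det_transpose]
    have : (Matrix.of fun i k : Fin n => (X k : MvPolynomial (Fin n) ℤ) ^ (i : ℕ)).transpose =
      Matrix.vandermonde (fun k => X k) := by ext1 i j; simp [Matrix.vandermonde_apply]
    rw [this, Matrix.det_vandermonde_ne_zero_iff]
    exact X_injective
  refine mul_right_cancel₀ hC0 ?_
  rw [← Matrix.det_mul, hC, mul_comm _ (Matrix.det (Matrix.of fun i k : Fin n => (X k : MvPolynomial (Fin n) ℤ) ^ (i : ℕ)))]
  have h2 : (Matrix.of fun i b : Fin n => hz n (-((i.rev : ℕ) : ℤ) + ((b.rev : ℕ) : ℤ))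
      - hz n (((i.rev : ℕ) : ℤ) + 1 + ((b.rev : ℕ) : ℤ))) * C = Matrix.of fun i k : Fin n =>
        (X k : MvPolynomial (Fin n) ℤ) ^ (i : ℕ) - X k ^ (2 * n - 1 - (i : ℕ)) := by
    ext1 i k
    rw [Matrix.mul_apply, Matrix.of_apply, ← key, ← key, ← Finset.sum_sub_distrib]
    refine Finset.sum_congr rfl fun b _ => ?_
    rw [Matrix.of_apply, sub_mul]
    congr 3 <;> rw [Fin.val_rev, Fin.val_rev] <;> omega
  rw [h2]
  let K := FractionRing (MvPolynomial (Fin n) ℤ)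
  let φ := algebraMap (MvPolynomial (Fin n) ℤ) K
  have hφ : Function.Injective φ := IsFractionRing.injective _ _
  apply hφ
  have := weylB n (fun i => φ (X i)) (fun i => by
    rw [Ne, map_eq_zero_iff _ hφ]; exact X_ne_zero i)
  have m1 : φ.mapMatrix (Matrix.of fun i k : Fin n =>
        (X k : MvPolynomial (Fin n) ℤ) ^ (i : ℕ) - X k ^ (2 * n - 1 - (i : ℕ))) =
      Matrix.of fun i k : Fin n => φ (X k) ^ (i : ℕ) - φ (X k) ^ (2 * n - 1 - (i : ℕ)) := by
    ext1 i j
    simp only [RingHom.mapMatrix_apply, Matrix.map_apply, Matrix.of_apply, map_sub, map_pow]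
  have m2 : φ.mapMatrix (Matrix.of fun i k : Fin n => (X k : MvPolynomial (Fin n) ℤ) ^ (i : ℕ)) =
      Matrix.of fun i k : Fin n => φ (X k) ^ (i : ℕ) := by
    ext1 i j
    simp only [RingHom.mapMatrix_apply, Matrix.map_apply, Matrix.of_apply, map_pow]
  rw [map_mul, map_mul, map_prod, map_prod, RingHom.map_det, RingHom.map_det, m1, m2, this]
  simp only [map_sub, map_mul, map_one]

/-- The signed dual Littlewood identity for self-conjugate partitions:
`∑_{λ = λ'} (-1)^{(|λ|+d(λ))/2} s_λ(x_1,…,x_n) = ∏_i (1-x_i) ∏_{i<j} (1-x_i x_j)`.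
Self-conjugate partitions with more than `n` rows contribute `0` since then
`s_λ(x_1,…,x_n) = 0`. -/
theorem stmt_13 (n : ℕ) :
    ∑ᶠ (μ : YoungDiagram) (_ : μ.transpose = μ),
        ((-1 : MvPolynomial (Fin n) ℤ) ^ ((μ.card + durfee μ) / 2) * schurPoly n μ)
      = (∏ i : Fin n, (1 - X i : MvPolynomial (Fin n) ℤ)) *
          ∏ p ∈ Finset.univ.filter (fun p : Fin n × Fin n => p.1 < p.2),
            (1 - X p.1 * X p.2 : MvPolynomial (Fin n) ℤ) := by
  classical
  have h1 : ∑ᶠ (μ : YoungDiagram) (_ : μ.transpose = μ),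
        ((-1 : MvPolynomial (Fin n) ℤ) ^ ((μ.card + durfee μ) / 2) * schurPoly n μ) =
      ∑ μ ∈ SC n, ((-1 : MvPolynomial (Fin n) ℤ) ^ ((μ.card + durfee μ) / 2) * schurPoly n μ) := by
    rw [← finsum_mem_finset_eq_sum]
    refine finsum_congr fun μ => ?_
    by_cases hμ : μ.transpose = μ
    · rw [finsum_eq_if, if_pos hμ, finsum_eq_if]
      split_ifs with h
      · rfl
      · rw [mem_SC] at h
        rw [schur_vanish n μ (by by_contra hc; exact h ⟨hμ, by omega⟩), mul_zero]
    · rw [finsum_eq_if, if_neg hμ, finsum_eq_if, if_neg]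
      rw [mem_SC]
      tauto
  rw [h1, ← final_det]
  have h2 := altsum (R := MvPolynomial (Fin n) ℤ)
    (fun (t : ℤ) (b : Fin n) => hz n (t + ((b.rev : ℕ) : ℤ))) n Matrix.detRowAlternating
  refine Eq.trans (Finset.sum_congr rfl fun μ hμ => ?_) h2
  rw [smul_eq_mul, schur_pad n μ n ((mem_SC n μ).1 hμ).2,
    ← Matrix.det_submatrix_equiv_self Fin.revPerm]
  rfl
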